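/- Let X_1,…,X_N be jointly distributed random variables with values in a finite type V whose joint distribution is causally isotropic, let n < N, let W be a finite type, and let f : V^n → W be contextual for position n, i.e. for any two prefixes x, x' ∈ V^n each having positive probability, f(x) = f(x') implies that the conditional distributions of X_{n+1} given X_{≤n} = x and given X_{≤n} = x' are equal. Then for every ω ∈ W with P(f(X_1,…,X_n) = ω) > 0, H(X_{n+1} | f(X_1,…,X_n) = ω) = H(X_{n+1} | (X_1,…,X_n)). -/

import Mathlib

open Finset

/-- Shannon entropy of a pmf `q` on a finite type, `H(q) = -∑ s, q s * log (q s)`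
(with the convention `0 * log 0 = 0`, which holds since `Real.log 0 = 0`). -/
noncomputable def shannonEntropy {S : Type*} [Fintype S] (q : S → ℝ) : ℝ :=
  -∑ s, q s * Real.log (q s)

/-- Marginal probability `P(X = a)` for a random variable `X` on a finite sample
space with joint pmf `p`. -/
noncomputable def probOf {Ω A : Type*} [Fintype Ω] [DecidableEq A]
    (p : Ω → ℝ) (X : Ω → A) (a : A) : ℝ :=
  ∑ ω, if X ω = a then p ω else 0

/-- Conditional pmf of `Y` given `X = a`: `b ↦ P(X = a, Y = b) / P(X = a)`. -/
noncomputable def condDist {Ω A B : Type*} [Fintype Ω] [DecidableEq A] [DecidableEq B]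
    (p : Ω → ℝ) (X : Ω → A) (Y : Ω → B) (a : A) : B → ℝ :=
  fun b => (∑ ω, if X ω = a ∧ Y ω = b then p ω else 0) / probOf p X a

/-- Conditional entropy `H(Y | X) = ∑_{a : P(X=a) > 0} P(X = a) · H(Y | X = a)`.
(Terms with `P(X = a) = 0` contribute `0` to the sum, so we may sum over all `a`.) -/
noncomputable def condEnt {Ω A B : Type*} [Fintype Ω] [Fintype A] [Fintype B]
    [DecidableEq A] [DecidableEq B] (p : Ω → ℝ) (X : Ω → A) (Y : Ω → B) : ℝ :=
  ∑ a, probOf p X a * shannonEntropy (condDist p X Y a)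

/-- Mutual information `I(X;Y) = H(Y) - H(Y|X)`. -/
noncomputable def mutInfo {Ω A B : Type*} [Fintype Ω] [Fintype A] [Fintype B]
    [DecidableEq A] [DecidableEq B] (p : Ω → ℝ) (X : Ω → A) (Y : Ω → B) : ℝ :=
  shannonEntropy (fun b => probOf p Y b) - condEnt p X Y

/-- The prefix `X_{≤i} = (X_1, …, X_i)` of the process `X_1, …, X_N`
(0-based: `X_k` is coordinate `k - 1`). -/
def prefixVar {N : ℕ} {V : Type*} (i : ℕ) (h : i ≤ N) : (Fin N → V) → Fin i → V :=
  fun ω k => ω (Fin.castLE h k)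

/-- A joint pmf of `X_1, …, X_N` is *causally isotropic* if for every `n < N`,
every index set `Λ ⊆ {1,…,n}` and any two positive-probability assignments
`xs, xs'` of values to the coordinates in `Λ`, the pointwise conditional entropies
`H(X_{n+1} | X_Λ = xs)` and `H(X_{n+1} | X_Λ = xs')` coincide. -/
def CausallyIsotropic {N : ℕ} {V : Type*} [Fintype V] [DecidableEq V]
    (p : (Fin N → V) → ℝ) : Prop :=
  ∀ (n : ℕ) (hn : n < N) (Λ : Finset (Fin N)), (∀ j ∈ Λ, (j : ℕ) < n) →
    ∀ xs xs' : {j // j ∈ Λ} → V,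
      0 < probOf p (fun ω (j : {j // j ∈ Λ}) => ω j.1) xs →
      0 < probOf p (fun ω (j : {j // j ∈ Λ}) => ω j.1) xs' →
      shannonEntropy
          (condDist p (fun ω (j : {j // j ∈ Λ}) => ω j.1) (fun ω => ω ⟨n, hn⟩) xs)
        = shannonEntropy
          (condDist p (fun ω (j : {j // j ∈ Λ}) => ω j.1) (fun ω => ω ⟨n, hn⟩) xs')

theorem probOf_congr {Ω A A' : Type*} [Fintype Ω] [DecidableEq A] [DecidableEq A']
    (p : Ω → ℝ) {X : Ω → A} {X' : Ω → A'} {a : A} {a' : A'}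
    (h : ∀ ω, X ω = a ↔ X' ω = a') : probOf p X a = probOf p X' a' := by
  simp only [probOf, h]

theorem condDist_congr {Ω A A' B : Type*} [Fintype Ω] [DecidableEq A] [DecidableEq A']
    [DecidableEq B] (p : Ω → ℝ) {X : Ω → A} {X' : Ω → A'} (Y : Ω → B) {a : A} {a' : A'}
    (h : ∀ ω, X ω = a ↔ X' ω = a') : condDist p X Y a = condDist p X' Y a' := by
  funext b
  simp only [condDist, probOf, h]

theorem probOf_nonneg {Ω A : Type*} [Fintype Ω] [DecidableEq A] {p : Ω → ℝ}
    (hp : ∀ ω, 0 ≤ p ω) (X : Ω → A) (a : A) : 0 ≤ probOf p X a :=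
  Finset.sum_nonneg fun ω _ => by split_ifs <;> simp [hp]

theorem sum_probOf {Ω A : Type*} [Fintype Ω] [Fintype A] [DecidableEq A] (p : Ω → ℝ)
    (X : Ω → A) : ∑ a, probOf p X a = ∑ ω, p ω := by
  simp only [probOf]
  rw [Finset.sum_comm]
  simp

theorem probOf_comp {Ω A B : Type*} [Fintype Ω] [Fintype A] [DecidableEq A] [DecidableEq B]
    (p : Ω → ℝ) (X : Ω → A) (f : A → B) (b : B) :
    probOf p (fun ω => f (X ω)) b = ∑ a, if f a = b then probOf p X a else 0 := by
  simp only [probOf, ← Finset.sum_filter (p := fun a => f a = b)]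
  rw [Finset.sum_comm]
  refine Finset.sum_congr rfl fun ω _ => ?_
  simp [Finset.sum_ite_eq]

theorem joint_comp {Ω A B C : Type*} [Fintype Ω] [Fintype A] [DecidableEq A] [DecidableEq B]
    [DecidableEq C] (p : Ω → ℝ) (X : Ω → A) (Y : Ω → C) (f : A → B) (b : B) (c : C) :
    (∑ ω, if f (X ω) = b ∧ Y ω = c then p ω else 0)
      = ∑ a, if f a = b then ∑ ω, (if X ω = a ∧ Y ω = c then p ω else 0) else 0 := by
  simp only [← Finset.sum_filter (p := fun a => f a = b)]
  rw [Finset.sum_comm]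
  refine Finset.sum_congr rfl fun ω _ => ?_
  simp only [ite_and]
  simp [Finset.sum_ite_eq]

theorem joint_eq_probOf_mul_condDist {Ω A B : Type*} [Fintype Ω] [DecidableEq A]
    [DecidableEq B] {p : Ω → ℝ} (hp : ∀ ω, 0 ≤ p ω) (X : Ω → A) (Y : Ω → B) (a : A) (b : B) :
    (∑ ω, if X ω = a ∧ Y ω = b then p ω else 0) = probOf p X a * condDist p X Y a b := by
  rcases eq_or_ne (probOf p X a) 0 with h | h
  · rw [h, zero_mul]
    refine le_antisymm (le_of_le_of_eq (Finset.sum_le_sum fun ω _ => ?_) h)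
      (Finset.sum_nonneg fun ω _ => by split_ifs <;> simp [hp])
    by_cases h1 : X ω = a <;> by_cases h2 : Y ω = b <;> simp [h1, h2, hp]
  · rw [condDist, mul_div_cancel₀ _ h]

/-- If the conditional distribution of `Y` given `X = a` is the same pmf `q` for every
positive-probability `a` in the fibre of `f` over `b`, then `q` is also the conditional
distribution of `Y` given `f X = b`. -/
theorem condDist_comp_eq {Ω A B C : Type*} [Fintype Ω] [Fintype A] [DecidableEq A]
    [DecidableEq B] [DecidableEq C] {p : Ω → ℝ} (hp : ∀ ω, 0 ≤ p ω) (X : Ω → A) (Y : Ω → C)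
    (f : A → B) {b : B} (hb : 0 < probOf p (fun ω => f (X ω)) b) {q : C → ℝ}
    (hq : ∀ a, f a = b → 0 < probOf p X a → condDist p X Y a = q) :
    condDist p (fun ω => f (X ω)) Y b = q := by
  funext c
  rw [condDist, div_eq_iff hb.ne', joint_comp, probOf_comp, Finset.mul_sum]
  refine Finset.sum_congr rfl fun a _ => ?_
  split_ifs with ha
  · rw [joint_eq_probOf_mul_condDist hp]
    rcases (probOf_nonneg hp X a).eq_or_lt' with h | h
    · simp [h]
    · rw [hq a ha h, mul_comm]
  · simp

theorem exists_probOf_pos_of_comp {Ω A B : Type*} [Fintype Ω] [Fintype A] [DecidableEq A]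
    [DecidableEq B] (p : Ω → ℝ) (X : Ω → A) (f : A → B) {b : B}
    (hb : 0 < probOf p (fun ω => f (X ω)) b) : ∃ a, f a = b ∧ 0 < probOf p X a := by
  rw [probOf_comp] at hb
  obtain ⟨a, -, ha⟩ := Finset.exists_lt_of_sum_lt (s := Finset.univ) (f := fun _ => (0 : ℝ))
    (by simpa using hb)
  split_ifs at ha with h
  · exact ⟨a, h, ha⟩
  · exact absurd ha (lt_irrefl _)

theorem CausallyIsotropic.entropy_condDist_prefixVar_eq {N : ℕ} {V : Type*} [Fintype V]
    [DecidableEq V] {p : (Fin N → V) → ℝ} (hiso : CausallyIsotropic p) {n : ℕ} (hn : n < N)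
    {x x' : Fin n → V} (hx : 0 < probOf p (prefixVar n hn.le) x)
    (hx' : 0 < probOf p (prefixVar n hn.le) x') :
    shannonEntropy (condDist p (prefixVar n hn.le) (fun ω => ω ⟨n, hn⟩) x)
      = shannonEntropy (condDist p (prefixVar n hn.le) (fun ω => ω ⟨n, hn⟩) x') := by
  let Λ : Finset (Fin N) := Finset.univ.filter fun j => (j : ℕ) < n
  have hΛ : ∀ j ∈ Λ, (j : ℕ) < n := fun j hj => (Finset.mem_filter.mp hj).2
  have key : ∀ (y : Fin n → V) (ω : Fin N → V), prefixVar n hn.le ω = y ↔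
      (fun j : {j // j ∈ Λ} => ω j.1) = fun j => y ⟨j.1, hΛ j.1 j.2⟩ := by
    intro y ω
    simp only [funext_iff]
    constructor
    · intro h j
      exact h ⟨j.1, hΛ j.1 j.2⟩
    · intro h k
      exact h ⟨Fin.castLE hn.le k, by simp [Λ]⟩
  rw [condDist_congr p _ (key x), condDist_congr p _ (key x')]
  rw [probOf_congr p (key x)] at hx
  rw [probOf_congr p (key x')] at hx'
  exact hiso n hn Λ hΛ _ _ hx hx'

/-- For causally isotropic data and a function `f` that is contextual
for position `n`, every positive-probability value `w` of `f(X_1,…,X_n)` satisfies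
`H(X_{n+1} | f(X_1,…,X_n) = w) = H(X_{n+1} | (X_1,…,X_n))`. -/
theorem pointwise_condEnt_eq_of_contextual_causallyIsotropic {N : ℕ} {V W : Type*}
    [Fintype V] [DecidableEq V] [Fintype W] [DecidableEq W]
    (p : (Fin N → V) → ℝ) (hp0 : ∀ x, 0 ≤ p x) (hp1 : ∑ x, p x = 1)
    (hiso : CausallyIsotropic p)
    (n : ℕ) (hn : n < N)
    (f : (Fin n → V) → W)
    (hf : ∀ x x' : Fin n → V,
      0 < probOf p (prefixVar n hn.le) x →
      0 < probOf p (prefixVar n hn.le) x' →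
      f x = f x' →
      condDist p (prefixVar n hn.le) (fun ω => ω ⟨n, hn⟩) x
        = condDist p (prefixVar n hn.le) (fun ω => ω ⟨n, hn⟩) x')
    (w : W)
    (hw : 0 < probOf p (fun ω => f (prefixVar n hn.le ω)) w) :
    shannonEntropy
        (condDist p (fun ω => f (prefixVar n hn.le ω)) (fun ω => ω ⟨n, hn⟩) w)
      = condEnt p (prefixVar n hn.le) (fun ω => ω ⟨n, hn⟩) := by
  obtain ⟨x₀, hx₀, hpos⟩ := exists_probOf_pos_of_comp p (prefixVar n hn.le) f hw
  rw [condDist_comp_eq hp0 (prefixVar n hn.le) (fun ω => ω ⟨n, hn⟩) f hw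
    fun x hx hxpos => hf x x₀ hxpos hpos (hx.trans hx₀.symm)]
  have hterm : ∀ x, probOf p (prefixVar n hn.le) x *
      shannonEntropy (condDist p (prefixVar n hn.le) (fun ω => ω ⟨n, hn⟩) x)
      = probOf p (prefixVar n hn.le) x *
        shannonEntropy (condDist p (prefixVar n hn.le) (fun ω => ω ⟨n, hn⟩) x₀) := by
    intro x
    rcases (probOf_nonneg hp0 (prefixVar n hn.le) x).eq_or_lt' with h | h
    · simp [h]
    · rw [hiso.entropy_condDist_prefixVar_eq hn h hpos]
  rw [condEnt, Finset.sum_congr rfl fun x _ => hterm x, ← Finset.sum_mul, sum_probOf, hp1,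
    one_mul]
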